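/- Assume p⁻_{s⁻} > 0 for every s⁻ ∈ S⁻. The Kolmogorov–Sinai entropy of the zip shift equals the folding entropy plus the entropy of the partition by cylinders of index −1: h_μ(σ) = F(σ) + H_μ(𝒞_{−1}), where F(σ) := ∫_{x̂ ∈ σ⁻¹(ε)} H_{μ_{x̂}}(ε|_{x̂}) dμ̂(x̂). -/

import Mathlib

open MeasureTheory Filter Real

namespace ZipShiftPaper

variable {Sm Sp : Type*}

/-- `s` is an admissible symbol for index `i`: a negative symbol (inl) if `i < 0`,
a positive symbol (inr) if `i ≥ 0`. -/
def Adm (i : ℤ) (s : Sm ⊕ Sp) : Prop :=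
  if i < 0 then s.isLeft = true else s.isRight = true

/-- The zip shift space: bilateral sequences with positive symbols on indices `≥ 0`
and negative symbols on indices `< 0`. -/
def ZipSpace (Sm Sp : Type*) := {x : ℤ → Sm ⊕ Sp // ∀ i, Adm i (x i)}

variable (φ : Sp → Sm)

/-- The transition function applied to a combined symbol. -/
def phiHat : Sm ⊕ Sp → Sm ⊕ Sp
  | .inl t => .inl t
  | .inr s => .inl (φ s)

lemma adm_shift (x : ZipSpace Sm Sp) (i : ℤ) :
    Adm i (if i = -1 then phiHat φ (x.1 0) else x.1 (i + 1)) := by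
  by_cases h : i = -1
  · subst h
    have h0 := x.2 0
    simp only [Adm, if_neg (by norm_num : ¬ (0:ℤ) < 0)] at h0
    simp only [if_pos rfl, Adm, if_pos (by norm_num : (-1:ℤ) < 0)]
    rcases hx : x.1 0 with t | s
    · rw [hx] at h0; simp at h0
    · simp [phiHat]
  · rw [if_neg h]
    have h1 := x.2 (i + 1)
    unfold Adm at h1 ⊢
    by_cases hi : i < 0
    · rw [if_pos hi]; rw [if_pos (by omega)] at h1; exact h1
    · rw [if_neg hi]; rw [if_neg (by omega)] at h1; exact h1

/-- The zip shift map `σ_φ`. -/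
def zipShift (x : ZipSpace Sm Sp) : ZipSpace Sm Sp :=
  ⟨fun i => if i = -1 then phiHat φ (x.1 0) else x.1 (i + 1), adm_shift φ x⟩

/-- The cylinder `C^s_i = {x : x_i = s}`. -/
def cyl (i : ℤ) (s : Sm ⊕ Sp) : Set (ZipSpace Sm Sp) := {x | x.1 i = s}

/-- The σ-algebra on the zip shift space, generated by the cylinders. -/
instance zipMS : MeasurableSpace (ZipSpace Sm Sp) :=
  .generateFrom {C | ∃ i s, C = cyl i s}

/-- The partition `𝒞_i` of `Σ` by cylinders of index `i`. -/
def cylPart (i : ℤ) : Set (Set (ZipSpace Sm Sp)) :=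
  {C | ∃ s : Sm ⊕ Sp, Adm i s ∧ C = cyl i s}

/-- Forward image of a partition: `f(P) = {f(A) : A ∈ P}`. -/
def pushPart {α : Type*} (f : α → α) (P : Set (Set α)) : Set (Set α) :=
  (Set.image f) '' P

/-- Pullback of a partition: `f⁻¹(P) = {f⁻¹(A) : A ∈ P}`. -/
def pullPart {α : Type*} (f : α → α) (P : Set (Set α)) : Set (Set α) :=
  (Set.preimage f) '' P

/-- `σ^j(P)` for `j : ℤ`: forward image for `j ≥ 0`, preimage for `j < 0`. -/
def powPart {α : Type*} (f : α → α) (j : ℤ) (P : Set (Set α)) : Set (Set α) :=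
  if 0 ≤ j then pushPart (f^[j.toNat]) P else pullPart (f^[(-j).toNat]) P

/-- Common refinement (correfinement) `⋁_{i ∈ t} P i` of a family of partitions:
all nonempty intersections of one element from each partition. -/
def corefine {α ι : Type*} (t : Set ι) (P : ι → Set (Set α)) : Set (Set α) :=
  {A | A.Nonempty ∧ ∃ g : ι → Set α, (∀ i ∈ t, g i ∈ P i) ∧ A = ⋂ i ∈ t, g i}

/-- The partition `𝒞_{n,…,n'}` by cylinders of indices from `n` to `n'`. -/
def cylRange (n n' : ℤ) : Set (Set (ZipSpace Sm Sp)) :=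
  corefine (Set.Icc n n') cylPart

/-- The `k`-th dynamical correfinement `⋁_{j=0}^{k-1} f^{-j}(P)`. -/
def dynRefine {α : Type*} (f : α → α) (P : Set (Set α)) (k : ℕ) : Set (Set α) :=
  corefine (Set.Iio k) (fun j : ℕ => pullPart (f^[j]) P)

/-- Entropy of a partition: `H_μ(P) = Σ_{A ∈ P} -μ(A) log μ(A)`. -/
noncomputable def partH {α : Type*} [MeasurableSpace α] (μ : Measure α)
    (P : Set (Set α)) : ℝ :=
  ∑' A : P, Real.negMulLog ((μ (A : Set α)).toReal)

variable (pp : Sp → ℝ) [Fintype Sp] [DecidableEq Sm]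

/-- The pushforward distribution `p⁻ = φ_* p⁺` on the negative symbols. -/
def pm (t : Sm) : ℝ := ∑ s ∈ Finset.univ.filter (fun s => φ s = t), pp s

/-- The weight of symbol `s` at coordinate `i`: `p⁺_s` for a positive symbol at `i ≥ 0`,
`p⁻_s` for a negative symbol at `i < 0`, and `0` for inadmissible pairs. -/
def wt : ℤ → Sm ⊕ Sp → ℝ
  | i, .inl t => if i < 0 then pm φ pp t else 0
  | i, .inr s => if 0 ≤ i then pp s else 0

/-- `μ` is the product measure determined by `p⁺` (coordinates independent, coordinate `i`
distributed as `p⁺` for `i ≥ 0` and as `p⁻ = φ_* p⁺` for `i < 0`). -/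
def IsProductMeasure (μ : Measure (ZipSpace Sm Sp)) : Prop :=
  ∀ (F : Finset ℤ) (c : ℤ → Sm ⊕ Sp),
    μ {x : ZipSpace Sm Sp | ∀ i ∈ F, x.1 i = c i}
      = ∏ i ∈ F, ENNReal.ofReal (wt φ pp i (c i))

/-- The fiber space `σ⁻¹(ε) = {σ⁻¹({x}) : x ∈ Σ}`: the partition of `Σ` into
preimages of points, viewed as a type. -/
def Fib (φ : Sp → Sm) := {A : Set (ZipSpace Sm Sp) // ∃ x, A = zipShift φ ⁻¹' {x}}

/-- The natural projection `π : Σ → σ⁻¹(ε)`, `π(y) = σ⁻¹({σ(y)})`. -/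
def fibProj (y : ZipSpace Sm Sp) : Fib φ :=
  ⟨zipShift φ ⁻¹' {zipShift φ y}, zipShift φ y, rfl⟩

/-- The quotient σ-algebra on `σ⁻¹(ε)`:
`Q` is measurable iff `π⁻¹(Q)` is measurable in `Σ`. -/
instance fibMS : MeasurableSpace (Fib φ) :=
  MeasurableSpace.map (fibProj φ) (zipMS)

/-- `X̂ = {x̂ : x ∈ X}`, the set of fibers of points of `X`. -/
def hatSet (X : Set (ZipSpace Sm Sp)) : Set (Fib φ) :=
  {A | ∃ x ∈ X, A.1 = zipShift φ ⁻¹' {x}}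

/-- The negative symbol `x_{-1}` of a point of the zip shift space. -/
def negSym (x : ZipSpace Sm Sp) : Sm :=
  (x.1 (-1)).getLeft (by
    have h := x.2 (-1)
    simpa [Adm, if_pos (by norm_num : (-1:ℤ) < 0)] using h)

/-- The preimage `x̂(s) = (…, x_{-2}; s, x_0, x_1, …)` of `x` under the zip shift,
determined by the choice of positive symbol `s ∈ φ⁻¹(x_{-1})` at coordinate `0`. -/
def prePoint (x : ZipSpace Sm Sp) (s : Sp) : ZipSpace Sm Sp :=
  ⟨fun j => if j = 0 then .inr s else x.1 (j - 1), by
    intro j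
    dsimp only
    by_cases h : j = 0
    · subst h
      simp [Adm]
    · rw [if_neg h]
      have h1 := x.2 (j - 1)
      unfold Adm at h1 ⊢
      by_cases hj : j < 0
      · rw [if_pos hj]; rw [if_pos (by omega)] at h1; exact h1
      · rw [if_neg hj]; rw [if_neg (by omega)] at h1; exact h1⟩

/-- The conditional measure `μ_{x̂}` on the fiber `x̂ = σ⁻¹({x})`, giving mass
`q^{x_{-1}}_s = p⁺_s / p⁻_{x_{-1}}` to the point `x̂(s)`, `s ∈ φ⁻¹(x_{-1})`. -/
noncomputable def condMeas (x : ZipSpace Sm Sp) : Measure (ZipSpace Sm Sp) :=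
  ∑ s ∈ Finset.univ.filter (fun s => φ s = negSym x),
    (ENNReal.ofReal (pp s / pm φ pp (negSym x))) • Measure.dirac (prePoint x s)

/-- The conditional measure attached to a fiber `A ∈ σ⁻¹(ε)`. -/
noncomputable def condMeasFib (A : Fib φ) : Measure (ZipSpace Sm Sp) :=
  condMeas φ pp A.2.choose

/-- The entropy `H_{μ_{x̂}}(ε|_{x̂})` of the restriction of the atomic partition to the
fiber `x̂`, with respect to the conditional measure `μ_{x̂}`. -/
noncomputable def fibH (A : Fib φ) : ℝ :=
  ∑' y : A.1,
    Real.negMulLog ((condMeasFib φ pp A {(y : ZipSpace Sm Sp)}).toReal)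

/-- The folding entropy `F(σ) = ∫ H_{μ_{x̂}}(ε|_{x̂}) dμ̂(x̂)`, where `μ̂ = π_* μ` is the
quotient measure on `σ⁻¹(ε)`. -/
noncomputable def foldH (μ : Measure (ZipSpace Sm Sp)) : ℝ :=
  ∫ A, fibH φ pp A ∂(μ.map (fibProj φ))

/-- A finite measurable partition (mod 0) of a probability space. -/
def IsFinPart {α : Type*} [MeasurableSpace α] (μ : Measure α) (P : Set (Set α)) : Prop :=
  P.Finite ∧ (∀ A ∈ P, MeasurableSet A) ∧ P.Pairwise Disjoint ∧ μ (⋃₀ P) = 1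


/-- The Kolmogorov–Sinai entropy: the supremum, over all finite measurable partitions `P`,
of the limits `h_μ(f, P) = lim_n H_μ(⋁_{j=0}^{n-1} f^{-j}P)/n`. -/
noncomputable def ksEntropy {α : Type*} [MeasurableSpace α] (μ : Measure α) (f : α → α) : ℝ :=
  sSup {h : ℝ | ∃ P : Set (Set α), IsFinPart μ P ∧
    Tendsto (fun n : ℕ => partH μ (dynRefine f P n) / n) atTop (nhds h)}


end ZipShiftPaper

open ZipShiftPaper


namespace ZipShiftPaper

lemma negMulLog_sum_le {κ : Type*} (t : Finset κ) (a : κ → ℝ) (ha : ∀ k, 0 ≤ a k) :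
    negMulLog (∑ k ∈ t, a k) ≤ ∑ k ∈ t, negMulLog (a k) := by
  rw [negMulLog, neg_mul, Finset.sum_mul, ← Finset.sum_neg_distrib]
  refine Finset.sum_le_sum fun k hk => ?_
  rcases (ha k).eq_or_lt with h | h
  · simp [← h]
  · have : a k ≤ ∑ k ∈ t, a k := Finset.single_le_sum (fun i _ => ha i) hk
    have := Real.log_le_log h this
    rw [negMulLog]
    nlinarith

/-- Gibbs' inequality. -/
lemma sum_negMulLog_le {ι : Type*} [Fintype ι] (a b : ι → ℝ) (ha : ∀ i, 0 ≤ a i)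
    (hb : ∀ i, 0 ≤ b i) (hab : ∀ i, b i = 0 → a i = 0) (h : ∑ i, b i ≤ ∑ i, a i) :
    ∑ i, negMulLog (a i) ≤ ∑ i, a i * (-Real.log (b i)) := by
  have key : ∀ i, negMulLog (a i) - a i * (-Real.log (b i)) ≤ b i - a i := by
    intro i
    rcases (ha i).eq_or_lt with h0 | h0
    · simpa [← h0] using hb i
    · have hbi : 0 < b i := (hb i).lt_of_ne' fun h => h0.ne' (hab i h)
      have h1 := Real.log_le_sub_one_of_pos (div_pos hbi h0)
      rw [Real.log_div hbi.ne' h0.ne'] at h1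
      have h2 := mul_le_mul_of_nonneg_left h1 h0.le
      rw [mul_sub, mul_sub, mul_div_cancel₀ _ h0.ne'] at h2
      rw [negMulLog]
      linarith
  have := Finset.sum_le_sum fun i (_ : i ∈ Finset.univ) => key i
  rw [Finset.sum_sub_distrib, Finset.sum_sub_distrib] at this
  linarith

lemma integral_comp_fintype {Ω κ : Type*} [MeasurableSpace Ω] {μ : Measure Ω}
    [IsFiniteMeasure μ] [Fintype κ] [MeasurableSpace κ] [MeasurableSingletonClass κ]
    {T : Ω → κ} (hT : Measurable T) (g : κ → ℝ) :
    ∫ x, g (T x) ∂μ = ∑ k, μ.real (T ⁻¹' {k}) * g k := by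
  rw [← integral_map (f := g) hT.aemeasurable
    (measurable_of_countable g).aestronglyMeasurable, integral_fintype .of_finite]
  simp [map_measureReal_apply hT]

lemma integrable_comp_fintype {Ω κ : Type*} [MeasurableSpace Ω] {μ : Measure Ω}
    [IsFiniteMeasure μ] [Fintype κ] [MeasurableSpace κ] [MeasurableSingletonClass κ]
    {T : Ω → κ} (hT : Measurable T) (g : κ → ℝ) : Integrable (fun x => g (T x)) μ :=
  (Integrable.of_finite (μ := μ.map T) (f := g)).comp_measurable hT

/-- The entropy of a finite-valued `V` is at most the cross entropy of `(V, Z)` relative to any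
subprobability vector `q`. -/
lemma sum_negMulLog_le_integral {Ω ι κ : Type*} [MeasurableSpace Ω] {μ : Measure Ω}
    [IsProbabilityMeasure μ] [Fintype ι] [MeasurableSpace ι] [MeasurableSingletonClass ι]
    [Fintype κ] [MeasurableSpace κ] [MeasurableSingletonClass κ]
    {V : Ω → ι} (hV : Measurable V) {Z : Ω → κ} (hZ : Measurable Z) (q : ι → κ → ℝ)
    (hq : ∀ i k, 0 ≤ q i k) (hq1 : ∑ i, ∑ k, q i k ≤ 1) (hq0 : ∀ᵐ x ∂μ, q (V x) (Z x) ≠ 0) :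
    ∑ i, negMulLog (μ.real (V ⁻¹' {i})) ≤ ∫ x, -Real.log (q (V x) (Z x)) ∂μ := by
  have hT : Measurable fun x => (V x, Z x) := hV.prodMk hZ
  have hone : ∑ p : ι × κ, μ.real ((fun x => (V x, Z x)) ⁻¹' {p}) = 1 := by
    have := integral_comp_fintype (μ := μ) hT fun _ => 1
    simpa using this.symm
  have hmarg : ∀ i, μ.real (V ⁻¹' {i}) = ∑ k, μ.real ((fun x => (V x, Z x)) ⁻¹' {(i, k)}) := by
    classical
    intro i
    have h1 := integral_comp_fintype (μ := μ) hT fun p => if p.1 = i then (1 : ℝ) else 0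
    have h2 := integral_comp_fintype (μ := μ) hV fun j => if j = i then (1 : ℝ) else 0
    simp only at h1 h2
    rw [h1, Fintype.sum_prod_type, Finset.sum_comm] at h2
    simpa using h2.symm
  have hg := sum_negMulLog_le (fun p : ι × κ => μ.real ((fun x => (V x, Z x)) ⁻¹' {p}))
    (fun p => q p.1 p.2) (fun _ => measureReal_nonneg) (fun p => hq _ _) (by
      rintro ⟨i, k⟩ h0
      simp only at h0
      rw [measureReal_eq_zero_iff]
      refine measure_mono_null ?_ hq0
      rintro x hx
      obtain ⟨rfl, rfl⟩ := Prod.mk.inj hx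
      simpa using h0) (by rw [hone, Fintype.sum_prod_type]; exact hq1)
  rw [← integral_comp_fintype (μ := μ) hT fun p => -Real.log (q p.1 p.2)] at hg
  refine le_trans ?_ hg
  rw [Fintype.sum_prod_type]
  refine Finset.sum_le_sum fun i _ => ?_
  rw [hmarg]
  exact negMulLog_sum_le _ _ fun _ => measureReal_nonneg

lemma sum_negMulLog_prod {S : Type*} [Fintype S] (p : S → ℝ) (hp : ∑ s, p s = 1) (n : ℕ) :
    ∑ w : Fin n → S, negMulLog (∏ j, p (w j)) = n * ∑ s, negMulLog (p s) := by
  induction n with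
  | zero => simp
  | succ n ih =>
    have h1 : ∑ w : Fin n → S, ∏ j, p (w j) = 1 := by
      classical
      rw [← Fintype.piFinset_univ, ← Finset.prod_univ_sum]
      simp [hp]
    rw [← (Fin.consEquiv fun _ => S).sum_comp, Fintype.sum_prod_type]
    simp only [Fin.consEquiv_apply, Fin.prod_univ_succ, Fin.cons_zero, Fin.cons_succ,
      negMulLog_mul, Finset.sum_add_distrib, ← Finset.sum_mul, ← Finset.mul_sum, h1, hp, ih]
    push_cast
    ring

/-- Transition weights of a channel on `ι` that changes its input with probability less
than `δ`. -/
noncomputable def noise {ι : Type*} [Fintype ι] [DecidableEq ι] (δ : ℝ) (a b : ι) : ℝ :=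
  if a = b then 1 - δ else δ / Fintype.card ι

lemma noise_pos {ι : Type*} [Fintype ι] [DecidableEq ι] {δ : ℝ} (h0 : 0 < δ) (h1 : δ < 1)
    (a b : ι) : 0 < noise δ a b := by
  have : (0 : ℝ) < Fintype.card ι := by exact_mod_cast Fintype.card_pos_iff.2 ⟨a⟩
  unfold noise
  split_ifs
  · linarith
  · positivity

lemma sum_noise_le {ι : Type*} [Fintype ι] [DecidableEq ι] {δ : ℝ} (h0 : 0 < δ) (b : ι) :
    ∑ a, noise δ a b ≤ 1 := by
  have hk : (0 : ℝ) < Fintype.card ι := by exact_mod_cast Fintype.card_pos_iff.2 ⟨b⟩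
  calc ∑ a, noise δ a b
      ≤ ∑ a : ι, ((if a = b then 1 - δ else 0) + δ / Fintype.card ι) := by
        refine Finset.sum_le_sum fun a _ => ?_
        unfold noise
        split_ifs
        · linarith [div_pos h0 hk]
        · linarith
    _ = 1 := by simp [Finset.sum_add_distrib]; field_simp; ring

lemma integral_neg_log_noise_le {Ω ι : Type*} [MeasurableSpace Ω] {ν : Measure Ω}
    [IsProbabilityMeasure ν] [Fintype ι] [DecidableEq ι] [MeasurableSpace ι]
    [MeasurableSingletonClass ι] {X Y : Ω → ι} (hX : Measurable X) (hY : Measurable Y) {δ : ℝ}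
    (h0 : 0 < δ) (h1 : δ < 1) (hXY : ν.real {x | X x ≠ Y x} ≤ δ) :
    ∫ x, -Real.log (noise δ (X x) (Y x)) ∂ν ≤
      -Real.log (1 - δ) + δ * -Real.log (δ / Fintype.card ι) := by
  have hne : Nonempty ι := ν.nonempty_of_neZero.map X
  have hk : (1 : ℝ) ≤ Fintype.card ι := by exact_mod_cast Fintype.card_pos
  have hS : MeasurableSet {x | X x ≠ Y x} := (measurableSet_eq_fun hX hY).compl
  have hl1 : 0 ≤ -Real.log (1 - δ) := by
    linarith [Real.log_nonpos (x := 1 - δ) (by linarith) (by linarith)]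
  have hl2 : 0 ≤ -Real.log (δ / Fintype.card ι) := by
    linarith [Real.log_nonpos (x := δ / Fintype.card ι) (by positivity)
      ((div_le_one (by linarith)).2 (by linarith))]
  calc ∫ x, -Real.log (noise δ (X x) (Y x)) ∂ν
      ≤ ∫ x, (-Real.log (1 - δ) + {x | X x ≠ Y x}.indicator
          (fun _ => -Real.log (δ / Fintype.card ι)) x) ∂ν := by
        refine integral_mono
          (integrable_comp_fintype (hX.prodMk hY) fun p : ι × ι => -Real.log (noise δ p.1 p.2))
          ((integrable_const _).add ((integrable_const _).indicator hS)) fun x => ?_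
        by_cases h : X x = Y x
        · simp [noise, h]
        · simp [noise, h]; linarith
    _ = -Real.log (1 - δ) + ν.real {x | X x ≠ Y x} * -Real.log (δ / Fintype.card ι) := by
        rw [integral_add (integrable_const _) ((integrable_const _).indicator hS),
          integral_indicator_const _ hS]
        simp
    _ ≤ _ := by gcongr

section ZipSpace

variable {Sm Sp : Type*}

/-- The `n`-th nonnegative coordinate as a positive symbol. -/
def posSym (x : ZipSpace Sm Sp) (n : ℕ) : Sp :=
  (x.1 n).getRight (by simpa [Adm, not_lt.2 (Int.natCast_nonneg n)] using x.2 n)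

lemma coe_posSym (x : ZipSpace Sm Sp) (n : ℕ) : x.1 n = .inr (posSym x n) := by
  simp [posSym]

lemma coe_negSym (x : ZipSpace Sm Sp) : x.1 (-1) = .inl (negSym x) := by
  simp [negSym]

lemma measurableSet_coord_eq (F : Finset ℤ) (c : ℤ → Sm ⊕ Sp) :
    MeasurableSet {x : ZipSpace Sm Sp | ∀ i ∈ F, x.1 i = c i} := by
  have : {x : ZipSpace Sm Sp | ∀ i ∈ F, x.1 i = c i} = ⋂ i ∈ F, cyl i (c i) := by
    ext x; simp [cyl]
  rw [this]
  exact F.measurableSet_biInter fun i _ => .basic _ ⟨i, _, rfl⟩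

/-- A set depending on finitely many coordinates is measurable. -/
lemma measurableSet_of_window [Finite Sm] [Finite Sp] (F : Finset ℤ) (A : Set (ZipSpace Sm Sp))
    (hA : ∀ x y : ZipSpace Sm Sp, (∀ i ∈ F, x.1 i = y.1 i) → x ∈ A → y ∈ A) :
    MeasurableSet A := by
  have : A = ⋃ w ∈ (fun (x : ZipSpace Sm Sp) (i : F) => x.1 i) '' A,
      ⋂ i : F, cyl (i : ℤ) (w i) := by
    ext y
    simp only [Set.mem_iUnion, Set.mem_image, Set.mem_iInter, cyl, Set.mem_ofPred_eq,
      exists_prop, exists_exists_and_eq_and]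
    exact ⟨fun hy => ⟨y, hy, fun _ => rfl⟩,
      fun ⟨x, hx, hxy⟩ => hA x y (fun i hi => (hxy ⟨i, hi⟩).symm) hx⟩
  rw [this]
  exact (Set.toFinite _).measurableSet_biUnion fun w _ =>
    .iInter fun i => .basic _ ⟨_, _, rfl⟩

lemma measurable_of_window [Finite Sm] [Finite Sp] {κ : Type*} [MeasurableSpace κ] [Countable κ]
    (F : Finset ℤ) (T : ZipSpace Sm Sp → κ)
    (hT : ∀ x y : ZipSpace Sm Sp, (∀ i ∈ F, x.1 i = y.1 i) → T x = T y) : Measurable T :=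
  measurable_to_countable' fun _ => measurableSet_of_window F _ fun x y hxy hx =>
    (hT x y hxy).symm.trans hx

lemma isPiSystem_coord_eq :
    IsPiSystem {A : Set (ZipSpace Sm Sp) |
      ∃ (F : Finset ℤ) (c : ℤ → Sm ⊕ Sp), A = {x | ∀ i ∈ F, x.1 i = c i}} := by
  rintro _ ⟨F, c, rfl⟩ _ ⟨G, d, rfl⟩ ⟨z, hz, hz'⟩
  refine ⟨F ∪ G, z.1, ?_⟩
  ext x
  simp only [Set.mem_inter_iff, Set.mem_ofPred_eq, Finset.mem_union] at hz hz' ⊢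
  constructor
  · rintro ⟨h, h'⟩ i (hi | hi)
    · rw [h i hi, hz i hi]
    · rw [h' i hi, hz' i hi]
  · exact fun h => ⟨fun i hi => (h i (.inl hi)).trans (hz i hi),
      fun i hi => (h i (.inr hi)).trans (hz' i hi)⟩

variable (φ : Sp → Sm)

lemma zipShift_apply (x : ZipSpace Sm Sp) (i : ℤ) :
    (zipShift φ x).1 i = if i = -1 then phiHat φ (x.1 0) else x.1 (i + 1) := rfl

lemma zipShift_iterate_apply (m : ℕ) (x : ZipSpace Sm Sp) (i : ℤ) :
    ((zipShift φ)^[m] x).1 i = if i < 0 then phiHat φ (x.1 (i + m)) else x.1 (i + m) := by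
  induction m generalizing x with
  | zero =>
    have h := x.2 i
    unfold Adm at h
    rcases hx : x.1 i with t | s <;> simp_all [phiHat]
  | succ m ih =>
    rw [Function.iterate_succ_apply, ih, zipShift_apply]
    have hh : ∀ s : Sm ⊕ Sp, phiHat φ (phiHat φ s) = phiHat φ s := by rintro (_ | _) <;> rfl
    by_cases h : i + m = -1
    · have h' : i + ((m + 1 : ℕ) : ℤ) = 0 := by push_cast; omega
      rw [if_pos h, if_pos (by omega), if_pos (by omega), hh, h']
    · rw [if_neg h]; push_cast; simp only [add_assoc]

lemma posSym_iterate (m n : ℕ) (x : ZipSpace Sm Sp) :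
    posSym ((zipShift φ)^[m] x) n = posSym x (n + m) := by
  have h1 := coe_posSym ((zipShift φ)^[m] x) n
  have h2 := coe_posSym x (n + m)
  rw [zipShift_iterate_apply, if_neg (by omega), ← Nat.cast_add, h2] at h1
  exact (Sum.inr.inj h1).symm

lemma negSym_zipShift (x : ZipSpace Sm Sp) : negSym (zipShift φ x) = φ (posSym x 0) := by
  have h1 := coe_negSym (zipShift φ x)
  have h2 := coe_posSym x 0
  rw [zipShift_apply, if_pos rfl] at h1
  simp only [Nat.cast_zero] at h2
  rw [h2] at h1
  exact (Sum.inl.inj h1).symm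

lemma iterate_eq_of_window (m : ℕ) (x y : ZipSpace Sm Sp) (a b : ℤ)
    (h : ∀ i ∈ Set.Icc (a + m) (b + m), x.1 i = y.1 i) (i : ℤ) (hi : i ∈ Set.Icc a b) :
    ((zipShift φ)^[m] x).1 i = ((zipShift φ)^[m] y).1 i := by
  have hi' := Set.mem_Icc.1 hi
  rw [zipShift_iterate_apply, zipShift_iterate_apply, h _ (Set.mem_Icc.2 (by omega))]

lemma measurable_zipShift [Finite Sm] [Finite Sp] : Measurable (zipShift φ) := by
  refine measurable_generateFrom ?_
  rintro _ ⟨i, s, rfl⟩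
  refine measurableSet_of_window {i + 1} _ fun x y hxy hx => ?_
  simp only [Finset.mem_singleton, forall_eq] at hxy
  simp only [cyl, Set.mem_preimage, Set.mem_ofPred_eq, zipShift_apply] at hx ⊢
  by_cases h : i = -1
  · subst h
    simpa [← show x.1 0 = y.1 0 from hxy] using hx
  · simpa [h, ← hxy] using hx

/-- A function on the zip shift space is local if it depends on finitely many coordinates. -/
def IsLocal {κ : Type*} (T : ZipSpace Sm Sp → κ) (m : ℕ) : Prop :=
  ∀ x y : ZipSpace Sm Sp, (∀ i ∈ Set.Icc (-m : ℤ) m, x.1 i = y.1 i) → T x = T y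

lemma IsLocal.mono {κ : Type*} {T : ZipSpace Sm Sp → κ} {m m' : ℕ} (hT : IsLocal T m)
    (h : m ≤ m') : IsLocal T m' := fun x y hxy =>
  hT x y fun i hi => hxy i ⟨by have := hi.1; omega, by have := hi.2; omega⟩

lemma IsLocal.measurable [Finite Sm] [Finite Sp] {κ : Type*} [MeasurableSpace κ] [Countable κ]
    {T : ZipSpace Sm Sp → κ} {m : ℕ} (hT : IsLocal T m) : Measurable T :=
  measurable_of_window (Finset.Icc (-m : ℤ) m) T fun x y hxy =>
    hT x y fun i hi => hxy i (by simpa using hi)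

lemma measureDense_isLocal [Finite Sm] [Finite Sp] {μ : Measure (ZipSpace Sm Sp)} [IsFiniteMeasure μ] :
    μ.MeasureDense {A | ∃ m, IsLocal (· ∈ A) m} := by
  refine Measure.MeasureDense.of_generateFrom_isSetAlgebra_finite μ ?_ (le_antisymm ?_ ?_)
  · refine ⟨⟨0, fun x y _ => by simp⟩, ?_, ?_⟩
    · rintro A ⟨m, hm⟩
      exact ⟨m, fun x y hxy => congrArg Not (hm x y hxy)⟩
    · rintro A B ⟨m, hm⟩ ⟨k, hk⟩
      exact ⟨max m k, fun x y hxy => congrArg₂ Or (hm.mono (le_max_left _ _) x y hxy)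
        (hk.mono (le_max_right _ _) x y hxy)⟩
  · refine MeasurableSpace.generateFrom_le ?_
    rintro _ ⟨i, s, rfl⟩
    refine .basic _ ⟨i.natAbs, fun x y hxy => ?_⟩
    have := hxy i ⟨by omega, by omega⟩
    simp only [cyl, Set.mem_ofPred_eq, this]
  · refine MeasurableSpace.generateFrom_le ?_
    rintro A ⟨m, hm⟩
    exact measurableSet_setOfPred.2 hm.measurable

lemma exists_isLocal_measureReal_ne_lt [Finite Sm] [Finite Sp] {μ : Measure (ZipSpace Sm Sp)} [IsFiniteMeasure μ] {ι : Type*}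
    [Fintype ι] [Nonempty ι] [MeasurableSpace ι] [MeasurableSingletonClass ι]
    {X : ZipSpace Sm Sp → ι} (hX : Measurable X) {δ : ℝ} (hδ : 0 < δ) :
    ∃ (m : ℕ) (Y : ZipSpace Sm Sp → ι), IsLocal Y m ∧ μ.real {x | X x ≠ Y x} ≤ δ := by
  classical
  have hk : (0 : ℝ) < Fintype.card ι := by exact_mod_cast Fintype.card_pos
  choose t ht hμt using fun a : ι => (measureDense_isLocal (μ := μ)).approx (X ⁻¹' {a})
    (hX (measurableSet_singleton a)) (measure_ne_top _ _) (δ / Fintype.card ι) (div_pos hδ hk)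
  choose m hm using ht
  let g : (ι → Prop) → ι := fun p => if h : ∃ a, p a then h.choose else Classical.arbitrary ι
  refine ⟨Finset.univ.sup m, fun x => g fun a => x ∈ t a, fun x y hxy => ?_, ?_⟩
  · exact congrArg g (funext fun a => (hm a).mono (Finset.le_sup (Finset.mem_univ a)) x y hxy)
  · have hsub : {x | X x ≠ g fun a => x ∈ t a} ⊆ ⋃ a, symmDiff (X ⁻¹' {a}) (t a) := by
      intro x hx
      by_contra hcon
      have hiff : ∀ a, X x = a ↔ x ∈ t a := by
        intro a
        have := fun h => hcon (Set.mem_iUnion.2 ⟨a, h⟩)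
        simp only [Set.mem_symmDiff, Set.mem_preimage, Set.mem_singleton_iff] at this
        tauto
      have hex : ∃ a, x ∈ t a := ⟨X x, (hiff _).1 rfl⟩
      refine hx ?_
      simp only [g, dif_pos hex]
      exact (hiff _).2 hex.choose_spec
    calc μ.real {x | X x ≠ g fun a => x ∈ t a}
        ≤ μ.real (⋃ a, symmDiff (X ⁻¹' {a}) (t a)) := measureReal_mono hsub
      _ ≤ ∑ a, μ.real (symmDiff (X ⁻¹' {a}) (t a)) := measureReal_iUnion_fintype_le _
      _ ≤ ∑ _a : ι, δ / Fintype.card ι := Finset.sum_le_sum fun a _ =>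
          ENNReal.toReal_le_of_le_ofReal (div_pos hδ hk).le (hμt a).le
      _ = δ := by simp; field_simp

lemma measurable_posSym_fin [Finite Sm] [Finite Sp] [MeasurableSpace Sp] (N : ℕ) :
    Measurable fun (x : ZipSpace Sm Sp) (i : Fin N) => posSym x i :=
  measurable_pi_lambda _ fun i => measurable_of_window {(i : ℤ)} _ fun x y hxy => by
    have h := hxy i (by simp)
    have h' : x.1 ((i : ℕ) : ℤ) = y.1 ((i : ℕ) : ℤ) := h
    rw [coe_posSym, coe_posSym] at h'
    exact Sum.inr.inj h'

variable {φ} [Fintype Sp] [DecidableEq Sm] {pp : Sp → ℝ} {μ : Measure (ZipSpace Sm Sp)}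

lemma IsProductMeasure.isProbabilityMeasure [Nonempty Sp] (hμ : IsProductMeasure φ pp μ) :
    IsProbabilityMeasure μ :=
  ⟨by simpa using hμ ∅ fun _ => .inr (Classical.arbitrary Sp)⟩

lemma wt_succ {i : ℤ} (hi : i ≠ -1) (s : Sm ⊕ Sp) : wt φ pp (i + 1) s = wt φ pp i s := by
  rcases s with t | s
  · simp only [wt, show i + 1 < 0 ↔ i < 0 by omega]
  · simp only [wt, show 0 ≤ i + 1 ↔ 0 ≤ i by omega]

lemma IsProductMeasure.measure_preimage_zipShift [Finite Sm] (hpp : ∀ s, 0 ≤ pp s)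
    (hμ : IsProductMeasure φ pp μ) (F : Finset ℤ) (c : ℤ → Sm ⊕ Sp) :
    μ (zipShift φ ⁻¹' {x | ∀ i ∈ F, x.1 i = c i}) = μ {x | ∀ i ∈ F, x.1 i = c i} := by
  classical
  rw [hμ F c]
  by_cases hF : -1 ∈ F
  · rcases hc : c (-1) with t | s
    · have hpre : zipShift φ ⁻¹' {x | ∀ i ∈ F, x.1 i = c i} =
          ⋃ s ∈ Finset.univ.filter (fun s => φ s = t), {x : ZipSpace Sm Sp |
            ∀ j ∈ F.map (addRightEmbedding 1), x.1 j = if j = 0 then .inr s else c (j - 1)} := by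
        ext x
        have hx0 : x.1 0 = .inr (posSym x 0) := coe_posSym x 0
        simp only [Set.mem_preimage, Set.mem_ofPred_eq, Finset.mem_filter_univ, Set.mem_iUnion,
          exists_prop, Finset.mem_map, addRightEmbedding_apply, forall_exists_index, and_imp,
          forall_apply_eq_imp_iff₂, zipShift_apply, add_sub_cancel_right]
        constructor
        · intro h
          have h0 := h _ hF
          rw [if_pos rfl, hc, hx0] at h0
          refine ⟨posSym x 0, Sum.inl.inj h0, fun i hi => ?_⟩
          by_cases hi' : i = -1
          · simp [hi', hx0]
          · rw [if_neg (by omega)]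
            simpa [hi'] using h i hi
        · rintro ⟨s, rfl, h⟩ i hi
          by_cases hi' : i = -1
          · subst hi'
            have := h _ hF
            rw [if_pos (neg_add_cancel 1)] at this
            have h0 : x.1 0 = .inr s := this
            rw [if_pos rfl, h0, hc]
            rfl
          · rw [if_neg hi', h i hi, if_neg (by omega)]
      rw [hpre, measure_biUnion_finset _ fun _ _ => measurableSet_coord_eq _ _]
      · have hs : ∀ s, μ {x : ZipSpace Sm Sp | ∀ j ∈ F.map (addRightEmbedding 1),
              x.1 j = if j = 0 then .inr s else c (j - 1)} =
            ENNReal.ofReal (pp s) * ∏ i ∈ F.erase (-1), ENNReal.ofReal (wt φ pp i (c i)) := by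
          intro s
          rw [hμ _ fun j => if j = 0 then .inr s else c (j - 1), Finset.prod_map,
            ← Finset.mul_prod_erase _ _ hF]
          congr 1
          refine Finset.prod_congr rfl fun i hi => ?_
          have := Finset.ne_of_mem_erase hi
          rw [addRightEmbedding_apply, add_sub_cancel_right, if_neg (by omega), wt_succ this]
        rw [Finset.sum_congr rfl fun s _ => hs s, ← Finset.sum_mul, ← ENNReal.ofReal_sum_of_nonneg fun s _ => hpp s,
          ← Finset.mul_prod_erase _ _ hF, hc]
        rfl
      · intro s _ s' _ hss
        refine Set.disjoint_left.2 fun x hx hx' => hss ?_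
        have h0 : (0 : ℤ) ∈ F.map (addRightEmbedding 1) := Finset.mem_map.2 ⟨-1, hF, rfl⟩
        have := (hx 0 h0).symm.trans (hx' 0 h0)
        simpa using this
    · rw [Finset.prod_eq_zero hF (by simp [hc, wt])]
      convert measure_empty (μ := μ)
      refine Set.eq_empty_of_forall_notMem fun x hx => ?_
      have := hx (-1) hF
      rw [coe_negSym, hc] at this
      simp at this
  · have hpre : zipShift φ ⁻¹' {x | ∀ i ∈ F, x.1 i = c i} =
        {x : ZipSpace Sm Sp | ∀ j ∈ F.map (addRightEmbedding 1), x.1 j = c (j - 1)} := by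
      ext x
      simp only [Set.mem_preimage, Set.mem_ofPred_eq, Finset.mem_map, addRightEmbedding_apply,
        forall_exists_index, and_imp, forall_apply_eq_imp_iff₂, zipShift_apply,
        add_sub_cancel_right]
      refine forall₂_congr fun i hi => ?_
      rw [if_neg (ne_of_mem_of_not_mem hi hF)]
    rw [hpre, hμ _ fun j => c (j - 1), Finset.prod_map]
    refine Finset.prod_congr rfl fun i hi => ?_
    rw [addRightEmbedding_apply, add_sub_cancel_right,
      wt_succ (ne_of_mem_of_not_mem hi hF)]

lemma IsProductMeasure.measurePreserving [Finite Sm] [Nonempty Sp] (hpp : ∀ s, 0 ≤ pp s)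
    (hμ : IsProductMeasure φ pp μ) : MeasurePreserving (zipShift φ) μ μ := by
  have := hμ.isProbabilityMeasure
  refine ⟨measurable_zipShift φ, ?_⟩
  refine ext_of_generate_finite _ ?_ isPiSystem_coord_eq ?_ ?_
  · refine le_antisymm (MeasurableSpace.generateFrom_le ?_) (MeasurableSpace.generateFrom_le ?_)
    · rintro _ ⟨i, s, rfl⟩
      exact .basic _ ⟨{i}, fun _ => s, by simp [cyl]⟩
    · rintro _ ⟨F, c, rfl⟩
      exact measurableSet_coord_eq F c
  · rintro _ ⟨F, c, rfl⟩
    rw [Measure.map_apply (measurable_zipShift φ) (measurableSet_coord_eq F c)]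
    exact hμ.measure_preimage_zipShift hpp F c
  · rw [Measure.map_apply (measurable_zipShift φ) .univ, Set.preimage_univ]

lemma IsProductMeasure.measureReal_posSym_eq (hpp : ∀ s, 0 ≤ pp s)
    (hμ : IsProductMeasure φ pp μ) (n : ℕ) (w : ℕ → Sp) :
    μ.real {x | ∀ j < n, posSym x j = w j} = ∏ j ∈ Finset.range n, pp (w j) := by
  have := hμ ((Finset.range n).map Nat.castEmbedding) fun i => .inr (w i.toNat)
  rw [Finset.prod_map] at this
  simp only [Finset.mem_map, Finset.mem_range, Nat.castEmbedding_apply, forall_exists_index,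
    and_imp, forall_apply_eq_imp_iff₂, coe_posSym, Sum.inr.injEq, Int.toNat_natCast, wt,
    Int.natCast_nonneg, if_true] at this
  rw [measureReal_def, this, ENNReal.toReal_prod]
  exact Finset.prod_congr rfl fun j _ => ENNReal.toReal_ofReal (hpp _)

lemma IsProductMeasure.measureReal_posSym_fin_eq [Nonempty Sp] (hpp : ∀ s, 0 ≤ pp s)
    (hμ : IsProductMeasure φ pp μ) (n : ℕ) (w : Fin n → Sp) :
    μ.real {x | ∀ j : Fin n, posSym x j = w j} = ∏ j, pp (w j) := by
  have := hμ.measureReal_posSym_eq hpp n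
    fun j => if h : j < n then w ⟨j, h⟩ else Classical.arbitrary Sp
  rw [← Fin.prod_univ_eq_prod_range] at this
  simp only [Fin.is_lt, dite_true] at this
  rw [← this]
  congr 1
  ext x
  simp only [Set.mem_ofPred_eq, Fin.forall_iff]
  exact forall₂_congr fun j hj => by rw [dif_pos hj]

lemma IsProductMeasure.measureReal_posSym_singleton [Finite Sm] [Nonempty Sp]
    (hpp : ∀ s, 0 ≤ pp s) (hμ : IsProductMeasure φ pp μ) (n : ℕ) (s : Sp) :
    μ.real {x | posSym x n = s} = pp s := by
  have h := ((hμ.measurePreserving hpp).iterate n).measureReal_preimage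
    (measurableSet_of_window {0} {x : ZipSpace Sm Sp | posSym x 0 = s} fun x y hxy hx => by
      have h0 : x.1 (0 : ℕ) = y.1 (0 : ℕ) := hxy 0 (by simp)
      rw [coe_posSym, coe_posSym] at h0
      exact (Sum.inr.inj h0).symm.trans hx).nullMeasurableSet
  have h1 := hμ.measureReal_posSym_eq hpp 1 fun _ => s
  simp only [Nat.lt_one_iff, forall_eq, Finset.range_one, Finset.prod_singleton] at h1
  simpa [Set.preimage, posSym_iterate, h1] using h

lemma IsProductMeasure.integral_neg_log [Finite Sm] [Nonempty Sp] (hpp : ∀ s, 0 ≤ pp s)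
    (hμ : IsProductMeasure φ pp μ) (n : ℕ) :
    Integrable (fun x => -Real.log (pp (posSym x n))) μ ∧
    ∫ x, -Real.log (pp (posSym x n)) ∂μ = ∑ s, negMulLog (pp s) := by
  have := hμ.isProbabilityMeasure
  let _ : MeasurableSpace Sp := ⊤
  have hm : Measurable fun x : ZipSpace Sm Sp => posSym x n :=
    (measurable_pi_apply (Fin.last n)).comp (measurable_posSym_fin (n + 1))
  refine ⟨integrable_comp_fintype hm fun s => -Real.log (pp s), ?_⟩
  rw [integral_comp_fintype hm fun s => -Real.log (pp s)]
  refine Finset.sum_congr rfl fun s _ => ?_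
  have : (fun x : ZipSpace Sm Sp => posSym x n) ⁻¹' {s} = {x | posSym x n = s} := rfl
  rw [this, hμ.measureReal_posSym_singleton hpp, negMulLog]
  ring

lemma IsProductMeasure.ae_ne_zero [Finite Sm] [Nonempty Sp] (hpp : ∀ s, 0 ≤ pp s)
    (hμ : IsProductMeasure φ pp μ) : ∀ᵐ x ∂μ, ∀ n, pp (posSym x n) ≠ 0 := by
  have := hμ.isProbabilityMeasure
  refine ae_all_iff.2 fun n => ?_
  have h : ∀ s, ∀ᵐ x ∂μ, posSym x n = s → pp s ≠ 0 := by
    intro s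
    by_cases hs : pp s = 0
    · have h0 := hμ.measureReal_posSym_singleton hpp n s
      rw [hs, measureReal_eq_zero_iff] at h0
      refine measure_mono_null (fun x hx => ?_) h0
      by_contra hne
      exact hx fun h => absurd h hne
    · exact .of_forall fun _ _ => hs
  filter_upwards [ae_all_iff.2 h] with x hx
  exact hx _ rfl

lemma IsProductMeasure.sum_negMulLog_iterate_le [Finite Sm] [Nonempty Sp] (hpp : ∀ s, 0 ≤ pp s)
    (hsum : ∑ s, pp s = 1) (hμ : IsProductMeasure φ pp μ) {ι : Type*}
    [Fintype ι] [MeasurableSpace ι] [MeasurableSingletonClass ι] {X : ZipSpace Sm Sp → ι}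
    (hX : Measurable X) {δ : ℝ} (h0 : 0 < δ) (h1 : δ < 1) :
    ∃ C : ℕ, ∀ n : ℕ,
      ∑ w : Fin n → ι, negMulLog (μ.real {x | ∀ j : Fin n, X ((zipShift φ)^[j] x) = w j}) ≤
        (n + C : ℕ) * ∑ s, negMulLog (pp s) +
          n * (-Real.log (1 - δ) + δ * -Real.log (δ / Fintype.card ι)) := by
  classical
  have := hμ.isProbabilityMeasure
  have hne : Nonempty ι := μ.nonempty_of_neZero.map X
  let _ : MeasurableSpace Sp := ⊤
  obtain ⟨m, Y, hY, hXY⟩ := exists_isLocal_measureReal_ne_lt (μ := μ) hX h0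
  refine ⟨2 * m, fun n => ?_⟩
  have hf : ∀ k, MeasurePreserving ((zipShift φ)^[k]) μ μ :=
    fun k => (hμ.measurePreserving hpp).iterate k
  have hXf : ∀ k, Measurable fun x => X ((zipShift φ)^[k] x) := fun k => hX.comp (hf k).measurable
  let V : ZipSpace Sm Sp → Fin n → ι := fun x j => X ((zipShift φ)^[j + m] x)
  let Z : ZipSpace Sm Sp → Fin (n + 2 * m) → Sp := fun x i => posSym x i
  have hV : Measurable V := measurable_pi_lambda _ fun j => hXf _
  have hfac : Function.FactorsThrough
      (fun (x : ZipSpace Sm Sp) (j : Fin n) => Y ((zipShift φ)^[j + m] x)) Z := by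
    intro x y hxy
    funext j
    refine hY _ _ fun i hi => iterate_eq_of_window φ (j + m) x y (-m) m (fun i hi => ?_) i hi
    have h1 := hi.1
    have h2 := hi.2
    obtain ⟨i, rfl⟩ := Int.eq_ofNat_of_zero_le (show 0 ≤ i by push_cast at h1; omega)
    rw [coe_posSym, coe_posSym]
    have := j.2
    exact congrArg Sum.inr (congrFun hxy ⟨i, by push_cast at h2; omega⟩)
  let G : (Fin (n + 2 * m) → Sp) → Fin n → ι :=
    Function.extend Z (fun (x : ZipSpace Sm Sp) (j : Fin n) => Y ((zipShift φ)^[j + m] x))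
      fun _ _ => Classical.arbitrary ι
  have hG : ∀ x j, G (Z x) j = Y ((zipShift φ)^[j + m] x) := fun x j =>
    congrFun (hfac.extend_apply _ x) j
  let q : (Fin n → ι) → (Fin (n + 2 * m) → Sp) → ℝ := fun v z =>
    (∏ i, pp (z i)) * ∏ j, noise δ (v j) (G z j)
  have hq1 : ∑ v, ∑ z, q v z ≤ 1 := by
    rw [Finset.sum_comm]
    calc ∑ z, ∑ v, q v z ≤ ∑ z : Fin (n + 2 * m) → Sp, ∏ i, pp (z i) := by
          refine Finset.sum_le_sum fun z _ => ?_
          simp only [q]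
          rw [← Finset.mul_sum]
          refine mul_le_of_le_one_right (Finset.prod_nonneg fun _ _ => hpp _) ?_
          rw [← Fintype.piFinset_univ, ← Finset.prod_univ_sum _ fun j a => noise δ a (G z j)]
          exact Finset.prod_le_one
            (fun j _ => Finset.sum_nonneg fun a _ => (noise_pos h0 h1 _ _).le)
            fun j _ => sum_noise_le h0 _
      _ = 1 := by
          rw [← Fintype.piFinset_univ, ← Finset.prod_univ_sum]
          simp [hsum]
  have hq0 : ∀ᵐ x ∂μ, q (V x) (Z x) ≠ 0 := by
    filter_upwards [hμ.ae_ne_zero hpp] with x hx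
    exact mul_ne_zero (Finset.prod_ne_zero_iff.2 fun i _ => hx i)
      (Finset.prod_ne_zero_iff.2 fun j _ => (noise_pos h0 h1 _ _).ne')
  have hmain := sum_negMulLog_le_integral hV (measurable_posSym_fin (n + 2 * m)) q
    (fun v z => mul_nonneg (Finset.prod_nonneg fun _ _ => hpp _)
      (Finset.prod_nonneg fun _ _ => (noise_pos h0 h1 _ _).le)) hq1 hq0
  have hlog : ∀ᵐ x ∂μ, -Real.log (q (V x) (Z x)) =
      ∑ i : Fin (n + 2 * m), -Real.log (pp (posSym x i)) +
        ∑ j : Fin n, -Real.log (noise δ (X ((zipShift φ)^[j + m] x))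
          (Y ((zipShift φ)^[j + m] x))) := by
    filter_upwards [hμ.ae_ne_zero hpp] with x hx
    simp only [q, hG, V, Z]
    rw [Real.log_mul (Finset.prod_ne_zero_iff.2 fun (i : Fin (n + 2 * m)) _ => hx i)
      (Finset.prod_ne_zero_iff.2 fun j _ => (noise_pos h0 h1 _ _).ne'),
      Real.log_prod fun (i : Fin (n + 2 * m)) _ => hx i,
      Real.log_prod fun j _ => (noise_pos h0 h1 _ _).ne',
      Finset.sum_neg_distrib, Finset.sum_neg_distrib, neg_add]
  have hint : ∀ k, Integrable (fun x => -Real.log (noise δ (X ((zipShift φ)^[k] x))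
      (Y ((zipShift φ)^[k] x)))) μ := fun k =>
    integrable_comp_fintype ((hXf k).prodMk (hY.measurable.comp (hf k).measurable))
      fun p : ι × ι => -Real.log (noise δ p.1 p.2)
  have hnoise : ∀ k, ∫ x, -Real.log (noise δ (X ((zipShift φ)^[k] x))
      (Y ((zipShift φ)^[k] x))) ∂μ ≤
        -Real.log (1 - δ) + δ * -Real.log (δ / Fintype.card ι) := fun k => by
    refine integral_neg_log_noise_le (hXf k) (hY.measurable.comp (hf k).measurable) h0 h1 ?_
    refine le_of_eq_of_le ?_ hXY
    exact (hf k).measureReal_preimage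
      (measurableSet_eq_fun hX hY.measurable).compl.nullMeasurableSet
  have hshift : ∀ w : Fin n → ι, μ.real {x | ∀ j : Fin n, X ((zipShift φ)^[j] x) = w j} =
      μ.real (V ⁻¹' {w}) := by
    intro w
    have hm : MeasurableSet {x | ∀ j : Fin n, X ((zipShift φ)^[j] x) = w j} := by
      rw [Set.ofPred_forall]
      exact .iInter fun j => hXf j (measurableSet_singleton (w j))
    rw [← (hf m).measureReal_preimage hm.nullMeasurableSet]
    congr 1
    ext x
    simp only [Set.mem_preimage, Set.mem_ofPred_eq, Set.mem_singleton_iff, V, funext_iff,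
      Function.iterate_add_apply]
  simp_rw [hshift]
  refine hmain.trans ?_
  have hI1 : Integrable (fun x => ∑ i : Fin (n + 2 * m), -Real.log (pp (posSym x i))) μ :=
    integrable_finsetSum _ fun i _ => (hμ.integral_neg_log hpp i).1
  have hI2 : Integrable (fun x => ∑ j : Fin n, -Real.log (noise δ
      (X ((zipShift φ)^[j + m] x)) (Y ((zipShift φ)^[j + m] x)))) μ :=
    integrable_finsetSum _ fun j _ => hint _
  rw [integral_congr_ae hlog, integral_add hI1 hI2,
    integral_finsetSum _ fun (i : Fin (n + 2 * m)) _ => (hμ.integral_neg_log hpp i).1,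
    integral_finsetSum _ fun (j : Fin n) _ => hint (j + m)]
  refine add_le_add (le_of_eq ?_) ?_
  · simp_rw [fun i => (hμ.integral_neg_log hpp i).2]
    simp
  · refine (Finset.sum_le_sum fun j _ => hnoise _).trans (le_of_eq ?_)
    simp
    ring

end ZipSpace

section Partition

variable {α : Type*} [MeasurableSpace α] {μ : Measure α}

lemma partH_range {ι : Type*} [Fintype ι] {g : ι → Set α} (hg : Function.Injective g) :
    partH μ (Set.range g) = ∑ i, negMulLog (μ.real (g i)) := by
  rw [partH, tsum_range (fun A => negMulLog (μ A).toReal) hg, tsum_fintype]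
  rfl

lemma partH_le_of_subset_range [IsProbabilityMeasure μ] {ι : Type*} [Fintype ι] {g : ι → Set α}
    {D : Set (Set α)} (hD : D ⊆ Set.range g) :
    partH μ D ≤ ∑ i, negMulLog (μ.real (g i)) := by
  classical
  choose s hs using fun A : D => hD A.2
  have hinj : Function.Injective s := fun A B h => Subtype.ext (by rw [← hs A, ← hs B, h])
  have := Fintype.ofInjective s hinj
  calc partH μ D = ∑ A : D, negMulLog (μ.real (g (s A))) := by
        rw [partH, tsum_fintype]
        exact Finset.sum_congr rfl fun A _ => by rw [hs A]; rfl
    _ = ∑ i ∈ Finset.univ.image s, negMulLog (μ.real (g i)) := by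
        rw [Finset.sum_image hinj.injOn]
    _ ≤ _ := Finset.sum_le_univ_sum_of_nonneg fun i =>
        negMulLog_nonneg measureReal_nonneg measureReal_le_one

/-- The atoms of a finite partition are, up to null sets, the level sets of a finite-valued
function. -/
lemma IsFinPart.exists_measurable [IsProbabilityMeasure μ] {P : Set (Set α)}
    (hP : IsFinPart μ P) [MeasurableSpace P] :
    ∃ X : α → P, Measurable X ∧ ∀ᵐ x ∂μ, ∀ A : P, x ∈ (A : Set α) ↔ X x = A := by
  classical
  obtain ⟨hfin, hmeas, hdisj, hone⟩ := hP
  have := hfin.to_subtype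
  have hne : Nonempty P := by
    by_contra h
    rw [not_nonempty_iff, Set.isEmpty_coe_sort] at h
    simp [h] at hone
  have hU : MeasurableSet (⋃₀ P) := .sUnion hfin.countable hmeas
  let X : α → P := fun x => if h : ∃ A : P, x ∈ (A : Set α) then h.choose else Classical.arbitrary P
  have hX : ∀ x, ∀ A : P, x ∈ (A : Set α) → X x = A := by
    intro x A hA
    have h : ∃ A : P, x ∈ (A : Set α) := ⟨A, hA⟩
    simp only [X, dif_pos h]
    by_contra hne
    exact Set.disjoint_left.1
      (hdisj h.choose.2 A.2 fun he => hne (Subtype.ext he)) h.choose_spec hA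
  refine ⟨X, measurable_to_countable' fun A => ?_, ?_⟩
  · by_cases hA : A = Classical.arbitrary P
    · have : X ⁻¹' {A} = (A : Set α) ∪ (⋃₀ P)ᶜ := by
        ext x
        simp only [Set.mem_preimage, Set.mem_singleton_iff, Set.mem_union, Set.mem_compl_iff]
        constructor
        · intro h
          by_cases hx : x ∈ ⋃₀ P
          · obtain ⟨B, hB, hxB⟩ := hx
            rw [hX x ⟨B, hB⟩ hxB] at h
            exact .inl (h ▸ hxB)
          · exact .inr hx
        · rintro (h | h)
          · exact hX x A h
          · rw [hA]
            exact dif_neg fun ⟨B, hB⟩ => h ⟨B, B.2, hB⟩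
      rw [this]
      exact (hmeas _ A.2).union hU.compl
    · have : X ⁻¹' {A} = (A : Set α) := by
        ext x
        refine ⟨fun h => ?_, hX x A⟩
        by_cases hx : ∃ B : P, x ∈ (B : Set α)
        · obtain ⟨B, hB⟩ := hx
          have : B = A := (hX x B hB).symm.trans h
          exact this ▸ hB
        · exact absurd (h.symm.trans (dif_neg hx)) hA
      rw [this]
      exact hmeas _ A.2
  · filter_upwards [(mem_ae_iff_prob_eq_one hU).2 hone] with x ⟨B, hB, hxB⟩ A
    refine ⟨hX x A, fun h => ?_⟩
    have : (⟨B, hB⟩ : P) = A := (hX x ⟨B, hB⟩ hxB).symm.trans h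
    exact this ▸ hxB

lemma partH_dynRefine_le [IsProbabilityMeasure μ] {f : α → α} (hf : MeasurePreserving f μ μ)
    {P : Set (Set α)} [Fintype P] {X : α → P}
    (hX : ∀ᵐ x ∂μ, ∀ A : P, x ∈ (A : Set α) ↔ X x = A) (n : ℕ) :
    partH μ (dynRefine f P n) ≤
      ∑ w : Fin n → P, negMulLog (μ.real {x | ∀ j : Fin n, X (f^[j] x) = w j}) := by
  have hsub : dynRefine f P n ⊆
      Set.range fun w : Fin n → P => {x | ∀ j : Fin n, f^[j] x ∈ (w j : Set α)} := by
    rintro _ ⟨-, g, hg, rfl⟩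
    choose w hwP hw using fun j : Fin n => hg j j.2
    refine ⟨fun j => ⟨w j, hwP j⟩, ?_⟩
    ext x
    simp only [Set.mem_ofPred_eq, Set.mem_iInter, Set.mem_Iio, ← Fin.forall_iff (n := n)
      (p := fun j => x ∈ g j), ← hw, Set.mem_preimage]
  refine (partH_le_of_subset_range hsub).trans (le_of_eq ?_)
  refine Finset.sum_congr rfl fun w _ => congrArg negMulLog (measureReal_congr ?_)
  filter_upwards [ae_all_iff.2 fun j : ℕ => (hf.iterate j).quasiMeasurePreserving.ae hX] with x hx
  exact propext (forall_congr' fun j => hx j (w j))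

end Partition

section ZipEntropy

variable {Sm Sp : Type*}

/-- The point with prescribed nonnegative coordinates and constant negative coordinates. -/
def pointOf (t : Sm) (w : ℕ → Sp) : ZipSpace Sm Sp :=
  ⟨fun i => if i < 0 then .inl t else .inr (w i.toNat), fun i => by
    by_cases h : i < 0 <;> simp [Adm, h]⟩

lemma posSym_pointOf (t : Sm) (w : ℕ → Sp) (n : ℕ) : posSym (pointOf t w) n = w n := by
  have h := coe_posSym (pointOf t w) n
  have h' : (pointOf t w).1 (n : ℤ) = if (n : ℤ) < 0 then .inl t else .inr (w (n : ℤ).toNat) := rfl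
  rw [h', if_neg (by omega)] at h
  exact (Sum.inr.inj h).symm

lemma injective_posSym_cyl [Nonempty Sm] [Nonempty Sp] (n : ℕ) :
    Function.Injective fun w : Fin n → Sp =>
      {x : ZipSpace Sm Sp | ∀ j : Fin n, posSym x j = w j} := by
  intro w w' h
  have hmem : pointOf (Classical.arbitrary Sm)
      (fun j => if h : j < n then w ⟨j, h⟩ else Classical.arbitrary Sp) ∈
      {x : ZipSpace Sm Sp | ∀ j : Fin n, posSym x j = w j} := fun j => by
    rw [posSym_pointOf, dif_pos j.2]
  have hmem' := hmem
  rw [show {x : ZipSpace Sm Sp | ∀ j : Fin n, posSym x j = w j} = _ from h] at hmem'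
  exact funext fun j => (hmem j).symm.trans (hmem' j)

variable (φ : Sp → Sm)

lemma mem_preimage_cyl_iff (n : ℕ) (s : Sp) (x : ZipSpace Sm Sp) :
    x ∈ (zipShift φ)^[n] ⁻¹' cyl 0 (.inr s) ↔ posSym x n = s := by
  have h := coe_posSym ((zipShift φ)^[n] x) 0
  rw [posSym_iterate, zero_add] at h
  have h' : ((zipShift φ)^[n] x).1 0 = .inr (posSym x n) := h
  change ((zipShift φ)^[n] x).1 0 = .inr s ↔ _
  rw [h', Sum.inr.injEq]

lemma dynRefine_cylPart_zero [Nonempty Sm] [Nonempty Sp] (n : ℕ) :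
    dynRefine (zipShift φ) (cylPart 0) n = Set.range fun w : Fin n → Sp =>
      {x : ZipSpace Sm Sp | ∀ j : Fin n, posSym x j = w j} := by
  ext A
  constructor
  · rintro ⟨⟨x, hx⟩, g, hg, rfl⟩
    refine ⟨fun j => posSym x j, ?_⟩
    ext y
    simp only [Set.mem_ofPred_eq, Set.mem_iInter, Set.mem_Iio, Fin.forall_iff] at hx ⊢
    refine forall₂_congr fun j hj => ?_
    obtain ⟨_, ⟨s, hs, rfl⟩, hgj⟩ := hg j hj
    obtain ⟨s, rfl⟩ : ∃ s', s = .inr s' := Sum.isRight_iff.1 (by simpa [Adm] using hs)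
    have hxj := hx j hj
    rw [← hgj, mem_preimage_cyl_iff] at hxj ⊢
    rw [hxj]
  · rintro ⟨w, rfl⟩
    let w' : ℕ → Sp := fun j => if h : j < n then w ⟨j, h⟩ else Classical.arbitrary Sp
    have hw' : ∀ j (h : j < n), w' j = w ⟨j, h⟩ := fun j h => dif_pos h
    refine ⟨⟨pointOf (Classical.arbitrary Sm) w', fun j => ?_⟩,
      fun j => (zipShift φ)^[j] ⁻¹' cyl 0 (.inr (w' j)),
      fun j _ => ⟨_, ⟨.inr (w' j), by simp [Adm], rfl⟩, rfl⟩, ?_⟩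
    · rw [posSym_pointOf, hw' j j.2]
    · ext y
      simp only [Set.mem_ofPred_eq, Set.mem_iInter, Set.mem_Iio, Fin.forall_iff,
        mem_preimage_cyl_iff]
      exact forall₂_congr fun j hj => by rw [hw' j hj]

lemma range_cyl_eq_cylPart_zero :
    Set.range (fun s : Sp => (cyl 0 (.inr s) : Set (ZipSpace Sm Sp))) = cylPart 0 := by
  ext A
  constructor
  · rintro ⟨s, rfl⟩
    exact ⟨_, by simp [Adm], rfl⟩
  · rintro ⟨s, hs, rfl⟩
    obtain ⟨s, rfl⟩ : ∃ s', s = .inr s' := Sum.isRight_iff.1 (by simpa [Adm] using hs)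
    exact ⟨s, rfl⟩

lemma range_cyl_eq_cylPart_neg_one :
    Set.range (fun t : Sm => (cyl (-1) (.inl t) : Set (ZipSpace Sm Sp))) = cylPart (-1) := by
  ext A
  constructor
  · rintro ⟨s, rfl⟩
    exact ⟨_, by simp [Adm], rfl⟩
  · rintro ⟨s, hs, rfl⟩
    obtain ⟨s, rfl⟩ : ∃ s', s = .inl s' := Sum.isLeft_iff.1 (by simpa [Adm] using hs)
    exact ⟨s, rfl⟩

lemma isFinPart_cylPart_zero [Finite Sp] (μ : Measure (ZipSpace Sm Sp))
    [IsProbabilityMeasure μ] : IsFinPart μ (cylPart 0) := by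
  refine ⟨?_, ?_, ?_, ?_⟩
  · rw [← range_cyl_eq_cylPart_zero]
    exact Set.finite_range _
  · rintro _ ⟨s, -, rfl⟩
    exact .basic _ ⟨0, s, rfl⟩
  · rintro _ ⟨s, -, rfl⟩ _ ⟨s', -, rfl⟩ hne
    refine Set.disjoint_left.2 fun x hx hx' => hne ?_
    rw [show s = s' from hx.symm.trans hx']
  · convert measure_univ (μ := μ)
    exact Set.eq_univ_of_forall fun x => ⟨_, ⟨x.1 0, x.2 0, rfl⟩, rfl⟩

instance : MeasurableSingletonClass (ZipSpace Sm Sp) where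
  measurableSet_singleton x := by
    have : ({x} : Set (ZipSpace Sm Sp)) = ⋂ i, cyl i (x.1 i) := by
      ext y
      simp only [Set.mem_singleton_iff, Set.mem_iInter]
      exact ⟨fun h i => h ▸ rfl, fun h => Subtype.ext (funext h)⟩
    rw [this]
    exact .iInter fun i => .basic _ ⟨i, _, rfl⟩

lemma prePoint_apply_zero (x : ZipSpace Sm Sp) (s : Sp) : (prePoint x s).1 0 = .inr s := rfl

lemma prePoint_injective (x : ZipSpace Sm Sp) : Function.Injective (prePoint x) := fun _ _ h =>
  Sum.inr.inj (congrArg (fun y : ZipSpace Sm Sp => y.1 0) h)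

lemma zipShift_prePoint (x : ZipSpace Sm Sp) (s : Sp) (hs : φ s = negSym x) :
    zipShift φ (prePoint x s) = x := by
  refine Subtype.ext (funext fun i => ?_)
  rw [zipShift_apply]
  by_cases hi : i = -1
  · rw [if_pos hi, prePoint_apply_zero, hi, coe_negSym, ← hs]
    rfl
  · rw [if_neg hi]
    change (if i + 1 = 0 then Sum.inr s else x.1 (i + 1 - 1)) = _
    rw [if_neg (by omega), add_sub_cancel_right]

lemma prePoint_zipShift (z : ZipSpace Sm Sp) : prePoint (zipShift φ z) (posSym z 0) = z := by
  refine Subtype.ext (funext fun j => ?_)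
  change (if j = 0 then Sum.inr (posSym z 0) else (zipShift φ z).1 (j - 1)) = _
  by_cases hj : j = 0
  · rw [if_pos hj, hj]
    exact (coe_posSym z 0).symm
  · rw [if_neg hj, zipShift_apply, if_neg (by omega), sub_add_cancel]

/-- The fiber over `x` is parametrized by the symbols in `φ⁻¹(x_{-1})`. -/
noncomputable def fiberEquiv (x : ZipSpace Sm Sp) :
    {s // φ s = negSym x} ≃ (zipShift φ ⁻¹' {x} : Set (ZipSpace Sm Sp)) where
  toFun s := ⟨prePoint x s, zipShift_prePoint φ x s s.2⟩
  invFun z := ⟨posSym z.1 0, (negSym_zipShift φ z.1).symm.trans (congrArg negSym z.2)⟩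
  left_inv s := Subtype.ext <| Sum.inr.inj <| (coe_posSym (prePoint x s) 0).symm.trans rfl
  right_inv z := Subtype.ext <|
    (congrArg (fun u => prePoint u (posSym z.1 0)) (show zipShift φ z.1 = x from z.2).symm).trans
      (prePoint_zipShift φ z.1)

variable {φ} [Fintype Sp] [DecidableEq Sm] {pp : Sp → ℝ} {μ : Measure (ZipSpace Sm Sp)}

/-- The entropy of the zip shift is the entropy of the distribution of the positive symbols. -/
lemma IsProductMeasure.ksEntropy_eq [Finite Sm] [Nonempty Sm] [Nonempty Sp]
    (hpp : ∀ s, 0 ≤ pp s) (hsum : ∑ s, pp s = 1) (hμ : IsProductMeasure φ pp μ) :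
    ksEntropy μ (zipShift φ) = ∑ s, negMulLog (pp s) := by
  classical
  have := hμ.isProbabilityMeasure
  refine IsGreatest.csSup_eq ⟨⟨cylPart 0, isFinPart_cylPart_zero μ, ?_⟩, ?_⟩
  · refine tendsto_const_nhds.congr' ?_
    filter_upwards [eventually_ne_atTop 0] with n hn
    rw [dynRefine_cylPart_zero, partH_range (injective_posSym_cyl n)]
    simp_rw [hμ.measureReal_posSym_fin_eq hpp]
    rw [sum_negMulLog_prod pp hsum, mul_div_cancel_left₀ _ (by exact_mod_cast hn)]
  · rintro h ⟨P, hP, hlim⟩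
    let _ : MeasurableSpace P := ⊤
    have := hP.1.fintype
    obtain ⟨X, hXm, hX⟩ := hP.exists_measurable
    have hk : (0 : ℝ) < Fintype.card P := by
      have : Nonempty P := μ.nonempty_of_neZero.map X
      exact_mod_cast Fintype.card_pos
    have hδ : ∀ δ : ℝ, 0 < δ → δ < 1 → h ≤ ∑ s, negMulLog (pp s) +
        (-Real.log (1 - δ) + (negMulLog δ + δ * Real.log (Fintype.card P))) := by
      intro δ h0 h1
      obtain ⟨C, hC⟩ := hμ.sum_negMulLog_iterate_le hpp hsum hXm h0 h1
      have hlim' : Tendsto (fun n : ℕ => (C * ∑ s, negMulLog (pp s)) / n +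
          (∑ s, negMulLog (pp s) +
            (-Real.log (1 - δ) + (negMulLog δ + δ * Real.log (Fintype.card P))))) atTop
          (nhds (0 + (∑ s, negMulLog (pp s) +
            (-Real.log (1 - δ) + (negMulLog δ + δ * Real.log (Fintype.card P)))))) :=
        (tendsto_const_div_atTop_nhds_zero_nat _).add_const _
      rw [zero_add] at hlim'
      refine le_of_tendsto_of_tendsto hlim hlim' ?_
      filter_upwards [eventually_gt_atTop 0] with n hn
      have hn' : (0 : ℝ) < n := by exact_mod_cast hn
      rw [div_le_iff₀ hn']
      refine ((partH_dynRefine_le (hμ.measurePreserving hpp) hX n).trans (hC n)).trans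
        (le_of_eq ?_)
      rw [Real.log_div h0.ne' hk.ne', negMulLog]
      push_cast
      field_simp
      ring
    have hcont : ContinuousAt (fun δ : ℝ => ∑ s, negMulLog (pp s) +
        (-Real.log (1 - δ) + (negMulLog δ + δ * Real.log (Fintype.card P)))) 0 := by
      have h1 : ContinuousAt (fun δ : ℝ => Real.log (1 - δ)) 0 :=
        (continuousAt_const.sub continuousAt_id).log (by simp)
      have h2 : ContinuousAt negMulLog 0 := continuous_negMulLog.continuousAt
      fun_prop
    have hlim := hcont.tendsto.mono_left (nhdsWithin_le_nhds (s := Set.Ioi 0))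
    simp only [sub_zero, Real.log_one, neg_zero, negMulLog_zero, zero_mul, add_zero] at hlim
    refine ge_of_tendsto hlim ?_
    filter_upwards [Ioo_mem_nhdsGT (zero_lt_one' ℝ)] with δ hδ'
    exact hδ δ hδ'.1 hδ'.2

lemma IsProductMeasure.partH_cylPart_neg_one [Fintype Sm] [Nonempty Sp] (hpp : ∀ s, 0 ≤ pp s)
    (hμ : IsProductMeasure φ pp μ) :
    partH μ (cylPart (-1)) = ∑ t, negMulLog (pm φ pp t) := by
  rw [← range_cyl_eq_cylPart_neg_one, partH_range]
  · refine Finset.sum_congr rfl fun t _ => congrArg negMulLog ?_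
    have h := hμ {-1} fun _ => .inl t
    simp only [Finset.mem_singleton, forall_eq, Finset.prod_singleton] at h
    rw [measureReal_def]
    exact (congrArg ENNReal.toReal h).trans
      (ENNReal.toReal_ofReal (Finset.sum_nonneg fun s _ => hpp s))
  · intro t t' h
    have hmem : pointOf t (fun _ => Classical.arbitrary Sp) ∈
        (cyl (-1) (.inl t) : Set (ZipSpace Sm Sp)) :=
      if_pos (e := Sum.inr (Classical.arbitrary Sp)) (show (-1 : ℤ) < 0 by norm_num)
    have hmem' := hmem
    rw [show (cyl (-1) (.inl t) : Set (ZipSpace Sm Sp)) = _ from h] at hmem'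
    exact Sum.inl.inj (hmem.symm.trans hmem')

lemma condMeas_prePoint (hpp : ∀ s, 0 ≤ pp s) (x : ZipSpace Sm Sp) (s : Sp)
    (hs : φ s = negSym x) :
    (condMeas φ pp x {prePoint x s}).toReal = pp s / pm φ pp (negSym x) := by
  classical
  have hnn : 0 ≤ pp s / pm φ pp (negSym x) :=
    div_nonneg (hpp s) (Finset.sum_nonneg fun s _ => hpp s)
  rw [← ENNReal.toReal_ofReal hnn, condMeas, Measure.coe_finsetSum, Finset.sum_apply,
    Finset.sum_eq_single s]
  · simp
  · intro s' _ hne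
    have : prePoint x s' ∉ ({prePoint x s} : Set (ZipSpace Sm Sp)) :=
      fun h => hne (prePoint_injective x h)
    simp [this]
  · intro h
    exact absurd (by simpa using hs) h

lemma fibH_fibProj (hpp : ∀ s, 0 ≤ pp s) (y : ZipSpace Sm Sp) :
    fibH φ pp (fibProj φ y) = ∑ s with φ s = φ (posSym y 0),
      negMulLog (pp s / pm φ pp (φ (posSym y 0))) := by
  have hx : (fibProj φ y).2.choose = zipShift φ y := by
    have h : y ∈ (fibProj φ y).1 := rfl
    rw [(fibProj φ y).2.choose_spec] at h
    exact h.symm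
  rw [← negSym_zipShift φ y, fibH, condMeasFib, hx]
  change ∑' z : (zipShift φ ⁻¹' {zipShift φ y} : Set (ZipSpace Sm Sp)),
    negMulLog (condMeas φ pp (zipShift φ y) {(z : ZipSpace Sm Sp)}).toReal = _
  rw [← (fiberEquiv φ (zipShift φ y)).tsum_eq, tsum_fintype,
    ← Finset.sum_subtype_eq_sum_filter, Finset.subtype_univ]
  exact Finset.sum_congr rfl fun s _ => congrArg negMulLog (condMeas_prePoint hpp _ _ s.2)

lemma IsProductMeasure.foldH_eq [Finite Sm] [Nonempty Sp] (hpp : ∀ s, 0 ≤ pp s)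
    (hμ : IsProductMeasure φ pp μ) :
    foldH φ pp μ = ∑ s, pp s * ∑ s' with φ s' = φ s, negMulLog (pp s' / pm φ pp (φ s)) := by
  have := hμ.isProbabilityMeasure
  let _ : MeasurableSpace Sp := ⊤
  let g : Sp → ℝ := fun s => ∑ s' with φ s' = φ s, negMulLog (pp s' / pm φ pp (φ s))
  have hm : Measurable fun x : ZipSpace Sm Sp => posSym x 0 :=
    (measurable_pi_apply (0 : Fin 1)).comp (measurable_posSym_fin 1)
  have hcomp : (fun y => fibH φ pp (fibProj φ y)) = fun y => g (posSym y 0) :=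
    funext fun y => fibH_fibProj hpp y
  have hproj : Measurable (fibProj φ) := fun _ hs => hs
  have hmeas : Measurable (fibH φ pp) := fun s hs => by
    have h : Measurable fun y => fibH φ pp (fibProj φ y) :=
      hcomp ▸ (measurable_of_countable g).comp hm
    exact h hs
  rw [foldH, integral_map hproj.aemeasurable hmeas.aestronglyMeasurable, hcomp,
    integral_comp_fintype hm g]
  exact Finset.sum_congr rfl fun s _ =>
    congrArg (· * g s) (hμ.measureReal_posSym_singleton hpp 0 s)

/-- The chain rule for the entropy of a distribution and its image under `φ`. -/
lemma sum_negMulLog_eq_add_pm [Fintype Sm] (hpm : ∀ t, 0 < pm φ pp t) :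
    ∑ s, negMulLog (pp s) =
      ∑ s, pp s * ∑ s' with φ s' = φ s, negMulLog (pp s' / pm φ pp (φ s)) +
        ∑ t, negMulLog (pm φ pp t) := by
  rw [← Finset.sum_fiberwise Finset.univ φ fun s => negMulLog (pp s),
    ← Finset.sum_fiberwise Finset.univ φ fun s => pp s * _, ← Finset.sum_add_distrib]
  refine Finset.sum_congr rfl fun t _ => ?_
  have h1 : ∑ s with φ s = t, pp s / pm φ pp t = 1 := by
    rw [← Finset.sum_div]
    exact div_self (hpm t).ne'
  have h2 : ∀ s, negMulLog (pp s) =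
      pm φ pp t * negMulLog (pp s / pm φ pp t) + pp s / pm φ pp t * negMulLog (pm φ pp t) := by
    intro s
    rw [← negMulLog_mul, div_mul_cancel₀ _ (hpm t).ne']
  rw [Finset.sum_congr rfl fun s _ => h2 s, Finset.sum_add_distrib, ← Finset.sum_mul, h1, one_mul,
    ← Finset.mul_sum]
  congr 1
  have h3 : ∀ s ∈ Finset.univ.filter (fun s => φ s = t),
      pp s * ∑ s' with φ s' = φ s, negMulLog (pp s' / pm φ pp (φ s)) =
        pp s * ∑ s' with φ s' = t, negMulLog (pp s' / pm φ pp t) := by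
    intro s hs
    rw [(Finset.mem_filter.1 hs).2]
  rw [Finset.sum_congr rfl h3, ← Finset.sum_mul]
  rfl

end ZipEntropy

end ZipShiftPaper

/-- `h_μ(σ) = F(σ) + H_μ(𝒞_{-1})`. -/
theorem statement16 {Sm Sp : Type*} [Fintype Sm] [Fintype Sp] [Nonempty Sm] [Nonempty Sp]
    [DecidableEq Sm]
    (φ : Sp → Sm) (hφ : Function.Surjective φ)
    (pp : Sp → ℝ) (hpp : ∀ s, 0 ≤ pp s) (hsum : ∑ s, pp s = 1)
    (hpm : ∀ t : Sm, 0 < pm φ pp t)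
    (μ : Measure (ZipSpace Sm Sp)) (hμ : IsProductMeasure φ pp μ) :
    ksEntropy μ (zipShift φ) = foldH φ pp μ + partH μ (cylPart (-1)) := by
  rw [hμ.ksEntropy_eq hpp hsum, hμ.foldH_eq hpp, hμ.partH_cylPart_neg_one hpp,
    sum_negMulLog_eq_add_pm hpm]
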